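/- Let R be a standard graded k-algebra, I an ideal generated by forms of degree d, and suppose reg(I^q) = aq + b for all q ≫ 0 (asymptotic linearity) and a*(I^q) = qd + a*(φ) for all q ≫ 0 (for some constant a*(φ)). Then a = d, and there exists an integer r with 0 ≤ r ≤ dim R such that reg(I^q) = qd + a*(φ) + r for all q ≫ 0; in particular qd + a*(φ) ≤ reg(I^q) ≤ qd + a*(φ) + dim R for q ≫ 0. -/

import Mathlib

open CategoryTheory

noncomputable section

universe u

namespace localCohomology

open Abelian Opposite

variable {R : Type u} [CommRing R]

lemma mk₀_comp_eq_zero_of_factor {X Y Z M : ModuleCat.{u} R} {i : ℕ} {e : Ext Z M i}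
    {f : X ⟶ Y} {g : Y ⟶ Z} (h : (Ext.mk₀ g).comp e (zero_add i) = 0) {k : X ⟶ Z}
    (hk : f ≫ g = k) : (Ext.mk₀ k).comp e (zero_add i) = 0 := by
  rw [← hk, ← Ext.mk₀_comp_mk₀_assoc, h, Ext.comp_zero]

/-- Precomposing a class of degree `i + 1` on the quotient of a projective module by a morphism of
short exact sequences amounts to precomposing a class of degree `i` on the kernel. -/
lemma exists_forall_mk₀_comp_eq_extClass_comp {S : ShortComplex (ModuleCat.{u} R)}
    (hS : S.ShortExact) [Projective S.X₂] {M : ModuleCat.{u} R} {i : ℕ} (e : Ext S.X₃ M (i + 1)) :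
    ∃ e' : Ext S.X₁ M i, ∀ {S' : ShortComplex (ModuleCat.{u} R)} (hS' : S'.ShortExact)
      (φ : S' ⟶ S), (Ext.mk₀ φ.τ₃).comp e (zero_add _) =
        hS'.extClass.comp ((Ext.mk₀ φ.τ₁).comp e' (zero_add i)) (add_comm 1 i) := by
  obtain ⟨e', rfl⟩ := precomp_extClass_surjective_of_projective_X₂ M hS i e
  refine ⟨e', fun hS' φ ↦ ?_⟩
  have h := ShortComplex.ShortExact.extClass_naturality hS' hS φ
  simp only [Ext.bilinearComp_apply_apply, Ext.precomp]
  rw [← Ext.comp_assoc (a₁₂ := 1) (a₂₃ := i + 1) _ _ _ (by lia) (by lia) (by lia), ← h,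
    Ext.comp_assoc (a₁₂ := 1) (a₂₃ := i) _ _ _ (by lia) (by lia) (by lia)]

/-- The morphism of short exact sequences of kernels induced by a commutative square. -/
def shortComplexKerMap {F N F' N' : Type u} [AddCommGroup F] [Module R F] [AddCommGroup N]
    [Module R N] [AddCommGroup F'] [Module R F'] [AddCommGroup N'] [Module R N']
    (p : F →ₗ[R] N) (p' : F' →ₗ[R] N') (f : F' →ₗ[R] F) (g : N' →ₗ[R] N)
    (h : p ∘ₗ f = g ∘ₗ p') : p'.shortComplexKer ⟶ p.shortComplexKer where
  τ₁ := ModuleCat.ofHom (f.restrict (p := p'.ker) (q := p.ker) fun x hx ↦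
    LinearMap.mem_ker.2 ((LinearMap.congr_fun h x).trans
      ((congrArg g (LinearMap.mem_ker.1 hx)).trans (map_zero g))))
  τ₂ := ModuleCat.ofHom f
  τ₃ := ModuleCat.ofHom g
  comm₁₂ := rfl
  comm₂₃ := by
    ext x
    exact LinearMap.congr_fun h x

/-- Dimension shifting: a class of degree `i + 1` on a quotient `N` of a projective module `F` comes
from a class `e'` of degree `i` on the kernel, and it is killed by `N' → N` as soon as the kernel
of a compatible `F' → N'` maps to a submodule on which `e'` vanishes. -/
lemma exists_forall_mk₀_comp_eq_zero {F N : Type u} [AddCommGroup F] [Module R F]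
    [AddCommGroup N] [Module R N] [Module.Projective R F] {p : F →ₗ[R] N}
    (hp : Function.Surjective p) {M : ModuleCat.{u} R} {i : ℕ}
    (e : Ext (ModuleCat.of R N) M (i + 1)) :
    ∃ e' : Ext (ModuleCat.of R p.ker) M i, ∀ W : Submodule R p.ker,
      (Ext.mk₀ (ModuleCat.ofHom W.subtype)).comp e' (zero_add i) = 0 →
      ∀ {F' N' : Type u} [AddCommGroup F'] [Module R F'] [AddCommGroup N'] [Module R N']
        (p' : F' →ₗ[R] N') (_ : Function.Surjective p') (f : F' →ₗ[R] F) (g : N' →ₗ[R] N),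
        p ∘ₗ f = g ∘ₗ p' → (∀ x, p' x = 0 → ∃ w ∈ W, (w : F) = f x) →
        (Ext.mk₀ (ModuleCat.ofHom g)).comp e (zero_add _) = 0 := by
  have : Projective p.shortComplexKer.X₂ := inferInstanceAs (Projective (ModuleCat.of R F))
  obtain ⟨e', he'⟩ := exists_forall_mk₀_comp_eq_extClass_comp
    (LinearMap.shortExact_shortComplexKer hp) e
  refine ⟨e', fun W hW F' N' _ _ _ _ p' hp' f g h hx ↦ ?_⟩
  let φ := shortComplexKerMap p p' f g h
  refine (he' (LinearMap.shortExact_shortComplexKer hp') φ).trans ?_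
  have hmem (x : p'.ker) : φ.τ₁.hom x ∈ W := by
    obtain ⟨w, hw, hwx⟩ := hx x x.2
    convert hw
    exact Subtype.ext hwx.symm
  rw [mk₀_comp_eq_zero_of_factor (f := ModuleCat.ofHom (LinearMap.codRestrict W φ.τ₁.hom hmem)) hW
    (by ext; rfl), Ext.comp_zero]

section Torsion

variable [IsNoetherianRing R]

/-- Every extension class of a finite module `N` by a module killed by a power of `J` becomes
trivial on `J ^ m • N` for some `m`. -/
lemma exists_mk₀_subtype_comp_eq_zero (J : Ideal R) {M : ModuleCat.{u} R} {s : ℕ}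
    (hs : ∀ a ∈ J ^ s, ∀ x : M, a • x = 0) (i : ℕ) (N : Type u) [AddCommGroup N] [Module R N]
    [Module.Finite R N] (e : Ext (ModuleCat.of R N) M i) :
    ∃ m : ℕ, (Ext.mk₀ (ModuleCat.ofHom (J ^ m • ⊤ : Submodule R N).subtype)).comp e
      (zero_add i) = 0 := by
  induction i generalizing N with
  | zero =>
    obtain ⟨f, rfl⟩ := (Ext.mk₀_bijective _ _).2 e
    refine ⟨s, ?_⟩
    rw [Ext.mk₀_comp_mk₀, Ext.mk₀_eq_zero_iff]
    ext ⟨x, hx⟩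
    change f.hom x = 0
    induction hx using Submodule.smul_induction_on' with
    | smul a ha y hy => rw [map_smul, hs a ha]
    | add x hx y hy h h' => rw [map_add, h, h', add_zero]
  | succ i ih =>
    obtain ⟨r, p, hp⟩ := Module.Finite.exists_fin' R N
    obtain ⟨k, hk⟩ := J.exists_pow_inf_eq_pow_smul p.ker
    obtain ⟨e', he'⟩ := exists_forall_mk₀_comp_eq_zero hp e
    obtain ⟨m, hm⟩ := ih p.ker e'
    have hmap : (J ^ (m + k) • ⊤ : Submodule R (Fin r → R)).map p = J ^ (m + k) • ⊤ := by
      rw [Submodule.map_smul'', Submodule.map_top, LinearMap.range_eq_top.2 hp]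
    refine ⟨m + k, he' _ hm (p.restrict fun x hx ↦ hmap ▸ Submodule.mem_map_of_mem hx) ?_
      (Submodule.subtype _) _ rfl ?_⟩
    · rintro ⟨y, hy⟩
      obtain ⟨x, hx, rfl⟩ := hmap.symm ▸ hy
      exact ⟨⟨x, hx⟩, rfl⟩
    · rintro ⟨x, hx⟩ hpx
      have hx' : x ∈ J ^ (m + k - k) • (J ^ k • ⊤ ⊓ p.ker : Submodule R (Fin r → R)) :=
        hk (m + k) (by lia) ▸ ⟨hx, congrArg Subtype.val hpx⟩
      rw [Nat.add_sub_cancel] at hx'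
      have hle : J ^ m • (J ^ k • ⊤ ⊓ p.ker : Submodule R (Fin r → R)) ≤
          (J ^ m • ⊤ : Submodule R p.ker).map p.ker.subtype := by
        rw [Submodule.map_smul'', Submodule.map_top, Submodule.range_subtype]
        exact Submodule.smul_mono le_rfl inf_le_right
      exact hle hx'

end Torsion

/-- The inverse system of the quotients `R ⧸ J ^ n`. -/
abbrev quotientPowers (J : Ideal R) : ℕᵒᵖ ⥤ ModuleCat.{u} R :=
  ringModIdeals (idealPowersDiagram J)

/-- The colimit of the groups `Ext^i(R ⧸ J ^ n, M)` vanishes: each class becomes trivial after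
restriction along some `R ⧸ J ^ m → R ⧸ J ^ n`. -/
def ExtColimitVanishes (J : Ideal R) (i : ℕ) (M : ModuleCat.{u} R) : Prop :=
  ∀ (n : ℕ) (e : Ext ((quotientPowers J).obj (op n)) M i), ∃ (m : ℕ) (h : n ≤ m),
    (Ext.mk₀ ((quotientPowers J).map (homOfLE h).op)).comp e (zero_add i) = 0

variable {J : Ideal R} {i : ℕ}

lemma quotientPowers_map_comp {n m m' : ℕ} (h : n ≤ m) (h' : m ≤ m') :
    (quotientPowers J).map (homOfLE h').op ≫ (quotientPowers J).map (homOfLE h).op =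
      (quotientPowers J).map (homOfLE (h.trans h')).op := by
  rw [← Functor.map_comp]
  rfl

/-- To kill a class at some stage, one may first restrict it to another stage. -/
lemma exists_mk₀_map_comp_eq_zero_of_le {M : ModuleCat.{u} R} {n m : ℕ} (h : n ≤ m)
    {e : Ext ((quotientPowers J).obj (op n)) M i}
    (he : ∃ (m' : ℕ) (h' : m ≤ m'), (Ext.mk₀ ((quotientPowers J).map (homOfLE h').op)).comp
      ((Ext.mk₀ ((quotientPowers J).map (homOfLE h).op)).comp e (zero_add i)) (zero_add i) = 0) :
    ∃ (m' : ℕ) (h' : n ≤ m'),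
      (Ext.mk₀ ((quotientPowers J).map (homOfLE h').op)).comp e (zero_add i) = 0 := by
  obtain ⟨m', h', he'⟩ := he
  refine ⟨m', h.trans h', ?_⟩
  rwa [Ext.mk₀_comp_mk₀_assoc, quotientPowers_map_comp] at he'

lemma ExtColimitVanishes.of_torsion [IsNoetherianRing R] {M : ModuleCat.{u} R} {s : ℕ}
    (hs : ∀ a ∈ J ^ s, ∀ x : M, a • x = 0) : ExtColimitVanishes J (i + 1) M := by
  intro n e
  obtain ⟨e', he'⟩ := exists_forall_mk₀_comp_eq_zero (Submodule.mkQ_surjective (J ^ n)) e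
  obtain ⟨m, hm⟩ := exists_mk₀_subtype_comp_eq_zero J hs i _ e'
  refine ⟨m + n, by lia, he' _ hm (Submodule.mkQ (J ^ (m + n))) (Submodule.mkQ_surjective _)
    LinearMap.id _ rfl fun x hx ↦ ?_⟩
  have hx : x ∈ J ^ m • J ^ n := by
    rwa [Submodule.mkQ_apply, Submodule.Quotient.mk_eq_zero, pow_add] at hx
  have hle : J ^ m • J ^ n ≤
      (J ^ m • ⊤ : Submodule R (J ^ n).mkQ.ker).map (J ^ n).mkQ.ker.subtype := by
    rw [Submodule.map_smul'', Submodule.map_top, Submodule.range_subtype, Submodule.ker_mkQ]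
  exact hle hx

lemma ExtColimitVanishes.of_shortExact {S : ShortComplex (ModuleCat.{u} R)} (hS : S.ShortExact)
    (h₁ : ExtColimitVanishes J i S.X₁) (h₃ : ExtColimitVanishes J i S.X₃) :
    ExtColimitVanishes J i S.X₂ := by
  intro n e
  obtain ⟨m, h, he⟩ := h₃ n (e.comp (Ext.mk₀ S.g) (add_zero i))
  rw [← Ext.comp_assoc (a₁₂ := i) (a₂₃ := i) _ _ _ (by lia) (by lia) (by lia)] at he
  obtain ⟨e₁, he₁⟩ := Ext.covariant_sequence_exact₂ _ hS _ he
  obtain ⟨m', h', he'⟩ := h₁ m e₁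
  refine exists_mk₀_map_comp_eq_zero_of_le h ⟨m', h', ?_⟩
  rw [← he₁, ← Ext.comp_assoc (a₁₂ := i) (a₂₃ := i) _ _ _ (by lia) (by lia) (by lia), he',
    Ext.zero_comp]

lemma mk₀_comp_comp_extClass_eq_zero {S : ShortComplex (ModuleCat.{u} R)} (hS : S.ShortExact)
    {X Y : ModuleCat.{u} R} {f : X ⟶ Y} {e : Ext Y S.X₃ i}
    (h : (Ext.mk₀ f).comp e (zero_add i) = 0) :
    (Ext.mk₀ f).comp (e.comp hS.extClass rfl) (zero_add (i + 1)) = 0 := by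
  rw [← Ext.comp_assoc (a₁₂ := i) (a₂₃ := i + 1) _ _ _ (by lia) (by lia) (by lia), h,
    Ext.zero_comp]

open Pointwise in
lemma ExtColimitVanishes.of_quotSMulTop {M : ModuleCat.{u} R} {x : R} (hx : x ∈ J)
    (reg : IsSMulRegular M x) (h : ExtColimitVanishes J i (ModuleCat.of R (QuotSMulTop x M))) :
    ExtColimitVanishes J (i + 1) M := by
  suffices H : ∀ (k n : ℕ) (e : Ext ((quotientPowers J).obj (op n)) M (i + 1)), x ^ k • e = 0 →
      ∃ (m : ℕ) (h : n ≤ m),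
        (Ext.mk₀ ((quotientPowers J).map (homOfLE h).op)).comp e (zero_add _) = 0 by
    intro n e
    refine H n n e ?_
    have hzero : x ^ n • 𝟙 ((quotientPowers J).obj (op n)) = 0 := by
      ext y
      obtain ⟨y, rfl⟩ := Submodule.mkQ_surjective (J ^ n) y
      exact (Submodule.Quotient.mk_eq_zero _).2
        (Ideal.mul_mem_right y _ (Ideal.pow_mem_pow hx n))
    rw [← Ext.mk₀_id_comp e, ← Ext.smul_comp, ← Ext.mk₀_smul, hzero, Ext.mk₀_zero, Ext.zero_comp]
  intro k
  induction k with
  | zero => exact fun n e he ↦ ⟨n, le_rfl, by rw [show e = 0 by simpa using he, Ext.comp_zero]⟩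
  | succ k ih =>
    intro n e he
    rw [pow_succ', mul_smul, Ext.smul_eq_comp_mk₀] at he
    obtain ⟨f, hf⟩ := Ext.covariant_sequence_exact₁ _ reg.smulShortComplex_shortExact
      (x ^ k • e) he rfl
    obtain ⟨m, hm, hfm⟩ := h n f
    refine exists_mk₀_map_comp_eq_zero_of_le hm (ih _ _ ?_)
    rw [← Ext.comp_smul, ← hf]
    exact mk₀_comp_comp_extClass_eq_zero reg.smulShortComplex_shortExact hfm

/-- **Grothendieck vanishing**, for the direct limit of the groups `Ext^i(R ⧸ J ^ n, M)`. -/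
theorem ExtColimitVanishes.of_supportDim_lt [IsNoetherianRing R] (J : Ideal R) (i : ℕ)
    (M : Type u) [AddCommGroup M] [Module R M] [Module.Finite R M]
    (h : Module.supportDim R M < i) : ExtColimitVanishes J i (ModuleCat.of R M) := by
  induction i generalizing M with
  | zero =>
    have : Subsingleton M := by
      by_contra hne
      rw [not_subsingleton_iff_nontrivial, ← Module.supportDim_ne_bot_iff_nontrivial (R := R)] at hne
      obtain ⟨n, hn⟩ := WithBot.ne_bot_iff_exists.1 hne
      rw [← hn] at h
      exact absurd (WithBot.coe_lt_coe.1 h) not_lt_zero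
    intro n e
    refine ⟨n, le_rfl, ?_⟩
    obtain ⟨f, rfl⟩ := (Ext.mk₀_bijective _ _).2 e
    have : f = 0 := by
      ext
      exact Subsingleton.elim (α := M) _ _
    rw [this, Ext.mk₀_zero, Ext.comp_zero]
  | succ i ih =>
    obtain ⟨s, hs⟩ : ∃ s, ∀ t ≥ s, Submodule.torsionBySet R M (J ^ s : Ideal R) =
      Submodule.torsionBySet R M (J ^ t : Ideal R) :=
      monotone_stabilizes_iff_noetherian.2 inferInstance
        ⟨fun s ↦ Submodule.torsionBySet R M (J ^ s : Ideal R), fun s t hst ↦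
          Submodule.torsionBySet_le_torsionBySet_of_subset (Ideal.pow_le_pow_right hst)⟩
    set G := Submodule.torsionBySet R M (J ^ s : Ideal R)
    have hhom : Subsingleton ((R ⧸ J) →ₗ[R] (M ⧸ G)) := by
      refine ⟨fun f g ↦ ?_⟩
      suffices H : ∀ f : (R ⧸ J) →ₗ[R] (M ⧸ G), f = 0 from (H f).trans (H g).symm
      intro f
      ext
      obtain ⟨z, hz⟩ := G.mkQ_surjective (f (J.mkQ 1))
      have hJ (a : R) (ha : a ∈ J) : a • z ∈ G := by
        rw [← Submodule.Quotient.mk_eq_zero, ← Submodule.mkQ_apply, map_smul, hz, ← map_smul,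
          ← map_smul]
        have : J.mkQ (a • (1 : R)) = 0 := by
          rw [Submodule.mkQ_apply, Submodule.Quotient.mk_eq_zero]
          simpa using ha
        rw [this, map_zero]
      have hzG : z ∈ G := by
        have hle : J ^ (s + 1) ≤ (LinearMap.toSpanSingleton R M z).ker := by
          rw [pow_succ, Ideal.mul_le]
          intro a ha c hc
          rw [LinearMap.mem_ker, LinearMap.toSpanSingleton_apply, mul_smul]
          exact (Submodule.mem_torsionBySet_iff _ _).1 (hJ c hc) ⟨a, ha⟩
        rw [hs (s + 1) (by lia), Submodule.mem_torsionBySet_iff]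
        exact fun a ↦ hle a.2
      change f (J.mkQ 1) = 0
      rw [← hz, Submodule.mkQ_apply, Submodule.Quotient.mk_eq_zero]
      exact hzG
    obtain ⟨x, hx, reg⟩ := IsSMulRegular.subsingleton_linearMap_iff.1 hhom
    rw [Ideal.annihilator_quotient] at hx
    have hdim : Module.supportDim R (QuotSMulTop x (M ⧸ G)) < i := by
      have h₁ := Module.supportDim_quotSMulTop_succ_le_of_notMem_minimalPrimes (R := R)
        (M := M ⧸ G) (fun _ ↦ reg.notMem_of_mem_minimalPrimes)
      have h₂ := (h₁.trans (Module.supportDim_le_of_surjective G.mkQ G.mkQ_surjective)).trans_lt h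
      generalize Module.supportDim R (QuotSMulTop x (M ⧸ G)) = D at h₂ ⊢
      rw [Nat.cast_succ] at h₂
      exact lt_of_add_lt_add_right h₂
    have hS : (ModuleCat.shortComplexOfCompEqZero G.subtype G.mkQ (by ext; simp)).ShortExact :=
      ModuleCat.shortComplex_shortExact _ (LinearMap.exact_subtype_mkQ G) G.injective_subtype
        G.mkQ_surjective
    exact .of_shortExact hS
      (.of_torsion fun a ha x ↦ Subtype.ext ((Submodule.mem_torsionBySet_iff _ _).1 x.2 ⟨a, ha⟩))
      (.of_quotSMulTop hx reg (ih _ hdim))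

end localCohomology

/-- A class in the homology of a chain complex in the opposite of a category of modules is
represented by a cocycle, and is killed by a morphism of complexes sending this cocycle to a
coboundary. -/
lemma ChainComplex.exists_cocycle_of_homology_unop {R : Type u} [Ring R]
    (K : ChainComplex (ModuleCat.{u} R)ᵒᵖ ℕ) (n p : ℕ)
    (w : (K.homology n).unop) :
    ∃ z : (K.X n).unop, (K.d (n + 1) n).unop z = 0 ∧
      ∀ (K' : ChainComplex (ModuleCat.{u} R)ᵒᵖ ℕ) (φ : K' ⟶ K) (g : (K'.X p).unop),
        (K'.d n p).unop g = (φ.f n).unop z → (HomologicalComplex.homologyMap φ n).unop w = 0 := by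
  obtain ⟨c, rfl⟩ := (ModuleCat.epi_iff_surjective (K.homologyι n).unop).1 inferInstance w
  refine ⟨(K.pOpcycles n).unop c, ?_, fun K' φ g hg ↦ ?_⟩
  · rw [← ModuleCat.comp_apply, ← unop_comp, K.d_pOpcycles]
    rfl
  · have h₁ : (HomologicalComplex.opcyclesMap φ n).unop c = (K'.fromOpcycles n p).unop g := by
      apply (ModuleCat.mono_iff_injective (K'.pOpcycles n).unop).1 inferInstance
      rw [← ModuleCat.comp_apply, ← ModuleCat.comp_apply, ← unop_comp, ← unop_comp,
        K'.p_fromOpcycles, hg, HomologicalComplex.p_opcyclesMap]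
      rfl
    rw [← ModuleCat.comp_apply, ← unop_comp, HomologicalComplex.homologyι_naturality, unop_comp,
      ModuleCat.comp_apply, h₁, ← ModuleCat.comp_apply, ← unop_comp,
      HomologicalComplex.homologyι_comp_fromOpcycles]
    rfl

namespace CategoryTheory

variable {R : Type u} [CommRing R]

lemma exists_abelianExt_forall_Ext_map_eq_zero {X Y : ModuleCat.{u} R} {i : ℕ}
    (e : ((_root_.Ext R (ModuleCat.{u} R) (i + 1)).obj (.op X)).obj Y) :
    ∃ α : Abelian.Ext X Y (i + 1), ∀ {X' : ModuleCat.{u} R} (f : X' ⟶ X),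
      (Abelian.Ext.mk₀ f).comp α (zero_add _) = 0 →
        ((_root_.Ext R (ModuleCat.{u} R) (i + 1)).map f.op).app Y e = 0 := by
  let F := ((linearYoneda R (ModuleCat.{u} R)).obj Y).rightOp
  let P := projectiveResolution X
  obtain ⟨z, hz, H⟩ := ChainComplex.exists_cocycle_of_homology_unop
    ((F.mapHomologicalComplex _).obj P.complex) (i + 1) i
    ((P.isoLeftDerivedObj F (i + 1)).inv.unop e)
  let z' : P.complex.X (i + 1) ⟶ Y := z
  refine ⟨P.extMk z' (i + 2) rfl hz, fun {X'} f hf ↦ ?_⟩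
  let P' := projectiveResolution X'
  let φ : ProjectiveResolution.Hom P' P f :=
    { hom := ProjectiveResolution.lift f P' P
      hom_f_zero_comp_π_f_zero := ProjectiveResolution.lift_commutes_zero f P' P }
  rw [ProjectiveResolution.mk₀_comp_extMk z' _ _ hz φ,
    ProjectiveResolution.extMk_eq_zero_iff _ _ _ _ _ i rfl] at hf
  obtain ⟨g, hg⟩ := hf
  have h₁ := H ((F.mapHomologicalComplex _).obj P'.complex) ((F.mapHomologicalComplex _).map φ.hom)
    g hg
  have h₂ := ConcreteCategory.congr_hom (congrArg Quiver.Hom.unop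
    (ProjectiveResolution.isoLeftDerivedObj_inv_naturality f P' P φ.hom
      (ProjectiveResolution.lift_commutes_zero f P' P) F (i + 1))) e
  apply (ModuleCat.mono_iff_injective (P'.isoLeftDerivedObj F (i + 1)).inv.unop).1 inferInstance
  exact h₂.trans (h₁.trans (map_zero _).symm)

end CategoryTheory

namespace localCohomology

open Limits Opposite

variable {R : Type u} [CommRing R]

lemma subsingleton_obj_of_extColimitVanishes {J : Ideal R} {i : ℕ} {M : ModuleCat.{u} R}
    (h : ExtColimitVanishes J (i + 1) M) : Subsingleton ((localCohomology J (i + 1)).obj M) := by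
  suffices H : ∀ x : (localCohomology J (i + 1)).obj M, x = 0 from
    ⟨fun x y ↦ (H x).trans (H y).symm⟩
  intro x
  let D := diagram (idealPowersDiagram J) (i + 1)
  have : PreservesFilteredColimitsOfSize.{0, 0} (forget (ModuleCat.{u} R)) :=
    preservesFilteredColimitsOfSize_shrink _
  obtain ⟨⟨⟨n⟩⟩, e, rfl⟩ := Concrete.isColimit_exists_rep (D ⋙ (evaluation _ _).obj M)
    (isColimitOfPreserves ((evaluation _ _).obj M) (colimit.isColimit D)) x
  obtain ⟨α, hα⟩ := exists_abelianExt_forall_Ext_map_eq_zero e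
  obtain ⟨m, hm, hαm⟩ := h n α
  have h₁ : (D.map (homOfLE hm).op.op).app M e = 0 :=
    hα ((quotientPowers J).map (homOfLE hm).op) hαm
  have h₂ := ConcreteCategory.congr_hom
    (NatTrans.congr_app (colimit.w D (homOfLE hm).op.op) M) e
  exact h₂.symm.trans ((congrArg ((colimit.ι D (op (op m))).app M) h₁).trans (map_zero _))

/-- **Grothendieck vanishing**: the local cohomology of a finite module over a Noetherian ring
vanishes above the dimension of its support. -/
theorem subsingleton_obj_of_supportDim_lt [IsNoetherianRing R] (J : Ideal R) {i : ℕ} (hi : i ≠ 0)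
    (M : Type u) [AddCommGroup M] [Module R M] [Module.Finite R M]
    (h : Module.supportDim R M < i) :
    Subsingleton ((localCohomology J i).obj (ModuleCat.of R M)) := by
  obtain ⟨i, rfl⟩ := Nat.exists_eq_succ_of_ne_zero hi
  exact subsingleton_obj_of_extColimitVanishes (.of_supportDim_lt J (i + 1) M h)

end localCohomology

/-- Suppose `reg(I^q) = aq + b` for `q ≫ 0` and `a*(I^q) = qd + c` for `q ≫ 0`
(where `c = a*(φ)`).  Then `a = d` and there is an integer `0 ≤ r ≤ dim R` with
`reg(I^q) = qd + c + r` for `q ≫ 0`; in particular `qd + c ≤ reg(I^q) ≤ qd + c + dim R` for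
`q ≫ 0`.  Here `reg` and `a*` are the actual invariants of the graded modules `I^q`, specified
through the gradings of their local cohomology modules. -/
theorem statement5
    {k A : Type} [Field k] [CommRing A] [Algebra k A]
    (𝒜 : ℕ → Submodule k A) [GradedAlgebra 𝒜]
    [IsNoetherianRing A]
    (hdeg0 : 𝒜 0 = 1)
    (hstd : Algebra.adjoin k ((𝒜 1 : Submodule k A) : Set A) = ⊤)
    (l : ℕ) (hdim : ringKrullDim A = l)
    (d m : ℕ) (F : Fin (m + 1) → A) (hF : ∀ i, F i ∈ 𝒜 d)
    (I : Ideal A) (hI : I = Ideal.span (Set.range F))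
    -- the natural ℤ-grading on each local cohomology module `H^i_{R₊}(I^q)`
    (g : ∀ (q i : ℕ), ℤ → AddSubgroup
      ((localCohomology (HomogeneousIdeal.irrelevant 𝒜).toIdeal i).obj
        (ModuleCat.of A (I ^ q : Ideal A))))
    (hint : ∀ q i, DirectSum.IsInternal (g q i))
    (hcompat : ∀ (n : ℕ) (a : A), a ∈ 𝒜 n → ∀ (q i : ℕ) (p : ℤ)
      (x : (localCohomology (HomogeneousIdeal.irrelevant 𝒜).toIdeal i).obj
        (ModuleCat.of A (I ^ q : Ideal A))),
      x ∈ g q i p → a • x ∈ g q i ((n : ℤ) + p))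
    -- `a*(I^q)` and `reg(I^q)`
    (astarf regf : ℕ → ℤ)
    (hastarf : ∀ q : ℕ, IsGreatest {p : ℤ | ∃ i : ℕ, g q i p ≠ ⊥} (astarf q))
    (hregf : ∀ q : ℕ, IsGreatest {x : ℤ | ∃ i : ℕ, ∃ p : ℤ, g q i p ≠ ⊥ ∧ x = p + i} (regf q))
    -- asymptotic linearity hypotheses
    (a b c : ℤ)
    (hlin : ∃ N : ℕ, ∀ q ≥ N, regf q = a * q + b)
    (hastarlin : ∃ N : ℕ, ∀ q ≥ N, astarf q = q * d + c) :
    a = d ∧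
    (∃ r : ℕ, r ≤ l ∧ ∃ N : ℕ, ∀ q ≥ N, regf q = q * d + c + r) ∧
    (∃ N : ℕ, ∀ q ≥ N, q * d + c ≤ regf q ∧ regf q ≤ q * d + c + l) := by
  have hvanish (q i : ℕ) (p : ℤ) (h : g q i p ≠ ⊥) : i ≤ l := by
    by_contra! hli
    have := localCohomology.subsingleton_obj_of_supportDim_lt
      (HomogeneousIdeal.irrelevant 𝒜).toIdeal (i := i) (by lia) (I ^ q : Ideal A)
      (((Module.supportDim_le_ringKrullDim A _).trans_eq hdim).trans_lt (by exact_mod_cast hli))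
    exact h (Subsingleton.elim _ _)
  have hreg (q : ℕ) : astarf q ≤ regf q ∧ regf q ≤ astarf q + l := by
    obtain ⟨⟨i, hi⟩, ha⟩ := hastarf q
    obtain ⟨⟨j, p, hp, hr⟩, hmax⟩ := hregf q
    have h₁ := hmax ⟨i, _, hi, rfl⟩
    have h₂ := ha ⟨j, hp⟩
    have h₃ := hvanish q j p hp
    lia
  obtain ⟨N₁, hN₁⟩ := hlin
  obtain ⟨N₂, hN₂⟩ := hastarlin
  have hbound (q : ℕ) (h₁ : N₁ ≤ q) (h₂ : N₂ ≤ q) :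
      0 ≤ (a - d) * q + (b - c) ∧ (a - d) * q + (b - c) ≤ l := by
    have := hreg q
    rw [hN₁ q h₁, hN₂ q h₂] at this
    constructor <;> linarith
  have had : a = d := by
    obtain ⟨hlow, hup⟩ := hbound (N₁ + N₂) (by lia) (by lia)
    obtain ⟨hlow', hup'⟩ := hbound (N₁ + N₂ + (l + 1)) (by lia) (by lia)
    push_cast at hlow hup hlow' hup'
    rcases lt_trichotomy a d with h | h | h
    · nlinarith
    · exact h
    · nlinarith
  subst had
  obtain ⟨hlow, hup⟩ := hbound (N₁ + N₂) (by lia) (by lia)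
  rw [sub_self, zero_mul, zero_add] at hlow hup
  refine ⟨rfl, ⟨(b - c).toNat, by lia, N₁, fun q hq ↦ ?_⟩, N₁, fun q hq ↦ ?_⟩
  · rw [hN₁ q hq, Int.toNat_of_nonneg hlow]
    ring
  · rw [hN₁ q hq]
    constructor <;> linarith
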